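/- Let f, g be proper convex lower semicontinuous functions on a real Hilbert space H with zer(∂f+∂g) nonempty, and let (y^k), (x^k), (w^k) be generated by the inertial Douglas–Rachford iteration (2.5) with parameters satisfying 0 ≤ α_k ≤ α < 1, 0 < λ̲ ≤ λ_k ≤ λ̄ < 2 and Σ_k α_k‖w^k − w^{k−1}‖² < +∞. Then there exists x̄ ∈ H such that (w^k) converges weakly to x̄, (y^k) converges weakly to prox_{γg}(x̄), (x^k) converges weakly to prox_{γg}(x̄), and prox_{γg}(x̄) = prox_{γf}(2·prox_{γg}(x̄) − x̄). -/

import Mathlib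

open Filter Topology Pointwise
open scoped RealInnerProductSpace

noncomputable section

/-- `f` is proper, convex and lower semicontinuous (extended-real-valued). -/
def ProperConvexLSC {H : Type*} [NormedAddCommGroup H] [InnerProductSpace ℝ H]
    (f : H → EReal) : Prop :=
  (∀ x, f x ≠ ⊥) ∧ (∃ x, f x ≠ ⊤) ∧
    (∀ x y : H, ∀ a b : ℝ, 0 ≤ a → 0 ≤ b → a + b = 1 →
      f (a • x + b • y) ≤ (a : EReal) * f x + (b : EReal) * f y) ∧
    LowerSemicontinuous f

/-- The convex subdifferential `∂f(x)`. -/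
def subdiff {H : Type*} [NormedAddCommGroup H] [InnerProductSpace ℝ H]
    (f : H → EReal) (x : H) : Set H :=
  {w | ∀ z, f x + ((⟪w, z - x⟫ : ℝ) : EReal) ≤ f z}

/-- Weak convergence of a sequence in a Hilbert space. -/
def WeakTendsto {H : Type*} [NormedAddCommGroup H] [InnerProductSpace ℝ H]
    (x : ℕ → H) (l : H) : Prop :=
  ∀ z : H, Tendsto (fun k => ⟪x k, z⟫) atTop (𝓝 (⟪l, z⟫))

/-- `p` is the proximal point of parameter `γ` of `f` at `c`, i.e. the
minimizer of `z ↦ γ f(z) + (1/2)‖z - c‖²`. -/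
def IsProx {H : Type*} [NormedAddCommGroup H] [InnerProductSpace ℝ H]
    (γ : ℝ) (f : H → EReal) (c p : H) : Prop :=
  ∀ z, (γ : EReal) * f p + ((1 / 2 * ‖p - c‖ ^ 2 : ℝ) : EReal)
      ≤ (γ : EReal) * f z + ((1 / 2 * ‖z - c‖ ^ 2 : ℝ) : EReal)

section Subdifferential

variable {H : Type*} [NormedAddCommGroup H] [InnerProductSpace ℝ H]

/-- A subgradient can exist at `p` only if a proper `f` is finite at `p`. -/
theorem ne_top_of_mem_subdiff {f : H → EReal} (hf : ProperConvexLSC f) {p u : H}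
    (hu : u ∈ subdiff f p) : f p ≠ ⊤ := by
  obtain ⟨-, ⟨z, hz⟩, -⟩ := hf
  intro hp
  have h := hu z
  rw [hp, EReal.top_add_coe] at h
  exact hz (top_le_iff.mp h)

/-- The subdifferential of a proper function is monotone. -/
theorem subdiff_monotone {f : H → EReal} (hf : ProperConvexLSC f) {p q u v : H}
    (hu : u ∈ subdiff f p) (hv : v ∈ subdiff f q) : 0 ≤ ⟪u - v, p - q⟫ := by
  have h₁ := hu q
  have h₂ := hv p
  lift f p to ℝ using ⟨ne_top_of_mem_subdiff hf hu, hf.1 p⟩ with a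
  lift f q to ℝ using ⟨ne_top_of_mem_subdiff hf hv, hf.1 q⟩ with b
  norm_cast at h₁ h₂
  simp only [inner_sub_left, inner_sub_right] at *
  linarith

/-- The optimality condition characterizing proximal points. -/
theorem IsProx.mem_subdiff {f : H → EReal} (hf : ProperConvexLSC f) {γ : ℝ} (hγ : 0 < γ)
    {c p : H} (hp : IsProx γ f c p) : γ⁻¹ • (c - p) ∈ subdiff f p := by
  obtain ⟨hbot, ⟨z₀, hz₀⟩, hconv, -⟩ := hf
  have hptop : f p ≠ ⊤ := by
    intro htop
    have h := hp z₀
    lift f z₀ to ℝ using ⟨hz₀, hbot z₀⟩ with b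
    rw [htop, EReal.coe_mul_top_of_pos hγ, EReal.top_add_coe, top_le_iff] at h
    exact EReal.coe_ne_top _ (mod_cast h)
  intro z
  by_cases hz : f z = ⊤
  · rw [hz]; exact le_top
  have key : ∀ t : ℝ, 0 < t → t ≤ 1 →
      0 ≤ γ * ((f z).toReal - (f p).toReal) + ⟪p - c, z - p⟫ + t * (‖z - p‖ ^ 2 / 2) := by
    intro t ht ht1
    have hc := hconv p z (1 - t) t (by linarith) ht.le (by ring)
    have hm := hp ((1 - t) • p + t • z)
    have hne := hbot ((1 - t) • p + t • z)
    have hexp : ‖(1 - t) • p + t • z - c‖ ^ 2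
        = ‖p - c‖ ^ 2 + 2 * t * ⟪p - c, z - p⟫ + t ^ 2 * ‖z - p‖ ^ 2 := by
      have : (1 - t) • p + t • z - c = (p - c) + t • (z - p) := by module
      rw [this, norm_add_sq_real, inner_smul_right, norm_smul, mul_pow, Real.norm_eq_abs, sq_abs]
      ring
    rw [hexp] at hm
    lift f p to ℝ using ⟨hptop, hbot p⟩ with a
    lift f z to ℝ using ⟨hz, hbot z⟩ with b
    have hlt : f ((1 - t) • p + t • z) ≠ ⊤ := by
      intro h
      rw [h, top_le_iff] at hc
      exact EReal.coe_ne_top _ (mod_cast hc)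
    lift f ((1 - t) • p + t • z) to ℝ using ⟨hlt, hne⟩ with r
    norm_cast at hc hm
    simp only [EReal.toReal_coe]
    have h₁ := mul_le_mul_of_nonneg_left hc hγ.le
    have h₂ : 0 ≤ t * (γ * (b - a) + ⟪p - c, z - p⟫ + t * (‖z - p‖ ^ 2 / 2)) := by
      nlinarith
    exact nonneg_of_mul_nonneg_right h₂ ht
  have hlim : 0 ≤ γ * ((f z).toReal - (f p).toReal) + ⟪p - c, z - p⟫ := by
    have htend : Tendsto (fun t : ℝ => γ * ((f z).toReal - (f p).toReal) + ⟪p - c, z - p⟫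
        + t * (‖z - p‖ ^ 2 / 2)) (𝓝[>] 0)
        (𝓝 (γ * ((f z).toReal - (f p).toReal) + ⟪p - c, z - p⟫ + 0 * (‖z - p‖ ^ 2 / 2))) := by
      apply Tendsto.mono_left _ nhdsWithin_le_nhds
      exact (Continuous.tendsto (by fun_prop) 0)
    rw [zero_mul, add_zero] at htend
    refine ge_of_tendsto htend ?_
    filter_upwards [Ioc_mem_nhdsGT (zero_lt_one' ℝ)] with t ht using key t ht.1 ht.2
  lift f p to ℝ using ⟨hptop, hbot p⟩ with a
  lift f z to ℝ using ⟨hz, hbot z⟩ with b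
  simp only [EReal.toReal_coe] at hlim
  norm_cast
  have hneg : ⟪p - c, z - p⟫ = -⟪c - p, z - p⟫ := by rw [← neg_sub c p, inner_neg_left]
  rw [hneg] at hlim
  rw [real_inner_smul_left]
  have : γ⁻¹ * ⟪c - p, z - p⟫ ≤ b - a := by
    rw [inv_mul_le_iff₀ hγ]; linarith
  linarith

end Subdifferential

section FirmlyNonexpansive

variable {H : Type*} [NormedAddCommGroup H] [InnerProductSpace ℝ H]

/-- Firm nonexpansiveness, in monotone form. -/
def FirmlyNonexpansive (J : H → H) : Prop :=
  ∀ c d, 0 ≤ ⟪(c - J c) - (d - J d), J c - J d⟫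

/-- Proximal maps are firmly nonexpansive. -/
theorem firmlyNonexpansive_of_isProx {f : H → EReal} (hf : ProperConvexLSC f) {γ : ℝ}
    (hγ : 0 < γ) {J : H → H} (hJ : ∀ c, IsProx γ f c (J c)) : FirmlyNonexpansive J := by
  intro c d
  have h := subdiff_monotone hf ((hJ c).mem_subdiff hf hγ) ((hJ d).mem_subdiff hf hγ)
  rw [← smul_sub, real_inner_smul_left] at h
  exact nonneg_of_mul_nonneg_right h (inv_pos.mpr hγ)

/-- `x = prox_{γf}(x + γu)` whenever `u ∈ ∂f(x)`. -/
theorem isProx_eq_of_mem_subdiff {f : H → EReal} (hf : ProperConvexLSC f) {γ : ℝ} (hγ : 0 < γ)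
    {p x u : H} (hp : IsProx γ f (x + γ • u) p) (hu : u ∈ subdiff f x) : p = x := by
  have h := subdiff_monotone hf (hp.mem_subdiff hf hγ) hu
  have he : γ⁻¹ • (x + γ • u - p) - u = -(γ⁻¹ • (p - x)) := by
    rw [smul_sub, smul_add, smul_smul, inv_mul_cancel₀ hγ.ne', one_smul, smul_sub]
    abel
  rw [he, inner_neg_left, real_inner_smul_left, real_inner_self_eq_norm_sq] at h
  have h0 : γ⁻¹ * ‖p - x‖ ^ 2 = 0 := le_antisymm (by linarith) (by positivity)
  have h1 : ‖p - x‖ = 0 := by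
    rcases mul_eq_zero.mp h0 with h | h
    · exact absurd h (inv_pos.mpr hγ).ne'
    · exact pow_eq_zero_iff two_ne_zero |>.mp h
  exact sub_eq_zero.mp (norm_eq_zero.mp h1)

theorem FirmlyNonexpansive.norm_sub_le {J : H → H} (hJ : FirmlyNonexpansive J) (c d : H) :
    ‖J c - J d‖ ≤ ‖c - d‖ := by
  have h := hJ c d
  have he : (c - J c) - (d - J d) = (c - d) - (J c - J d) := by abel
  rw [he, inner_sub_left, real_inner_self_eq_norm_sq] at h
  have h2 := real_inner_le_norm (c - d) (J c - J d)
  by_contra! hlt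
  nlinarith [norm_nonneg (c - d), norm_nonneg (J c - J d)]

/-- The Douglas–Rachford step is firmly quasi-nonexpansive with respect to its fixed points. -/
theorem inner_douglasRachford_step_le {JA JB : H → H} (hA : FirmlyNonexpansive JA)
    (hB : FirmlyNonexpansive JB) {s : H} (hs : JB s = JA ((2 : ℝ) • JB s - s)) (z : H) :
    ⟪z - s, JA ((2 : ℝ) • JB z - z) - JB z⟫ ≤ -‖JA ((2 : ℝ) • JB z - z) - JB z‖ ^ 2 := by
  have h₁ := hB z s
  have h₂ := hA ((2 : ℝ) • JB z - z) ((2 : ℝ) • JB s - s)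
  rw [← hs] at h₂
  generalize JA ((2 : ℝ) • JB z - z) = x at *
  generalize JB z = y at *
  generalize JB s = p at *
  rw [← real_inner_self_eq_norm_sq]
  simp only [inner_sub_left, inner_sub_right, real_inner_smul_left] at *
  linarith [real_inner_comm x y, real_inner_comm x z, real_inner_comm x p, real_inner_comm x s,
    real_inner_comm y z, real_inner_comm y p, real_inner_comm y s, real_inner_comm z p,
    real_inner_comm z s, real_inner_comm p s]

/-- Weak limits along a filter of asymptotic Douglas–Rachford fixed points are fixed points. -/
theorem douglasRachford_demiclosed {JA JB : H → H} (hA : FirmlyNonexpansive JA)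
    (hB : FirmlyNonexpansive JB) {l : Filter ℕ} [l.NeBot] {z y x : ℕ → H} {zl yl : H} {C : ℝ}
    (hy : ∀ᶠ k in l, y k = JB (z k)) (hx : ∀ᶠ k in l, x k = JA ((2 : ℝ) • y k - z k))
    (hC : ∀ᶠ k in l, ‖z k‖ ≤ C)
    (hxy : Tendsto (fun k => x k - y k) l (𝓝 0))
    (hz : ∀ v, Tendsto (fun k => ⟪z k, v⟫) l (𝓝 ⟪zl, v⟫))
    (hyl : ∀ v, Tendsto (fun k => ⟪y k, v⟫) l (𝓝 ⟪yl, v⟫)) :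
    yl = JB zl ∧ yl = JA ((2 : ℝ) • yl - zl) := by
  set p := JB zl with hp
  set q := JA ((2 : ℝ) • yl - zl) with hq
  have hcross : Tendsto (fun k => ⟪x k - y k, z k⟫) l (𝓝 0) := by
    have h0 : Tendsto (fun k => ‖x k - y k‖ * C) l (𝓝 0) := by
      simpa using hxy.norm.mul_const C
    refine squeeze_zero_norm' ?_ h0
    filter_upwards [hC] with k hk
    exact (norm_inner_le_norm (𝕜 := ℝ) _ _).trans (mul_le_mul_of_nonneg_left hk (norm_nonneg _))
  have hxyv : ∀ v, Tendsto (fun k => ⟪x k - y k, v⟫) l (𝓝 0) := fun v => by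
    simpa using hxy.inner (tendsto_const_nhds (x := v))
  have hsq : Tendsto (fun k => ⟪x k - y k, x k - y k⟫) l (𝓝 0) := by
    simpa using hxy.inner (𝕜 := ℝ) hxy
  set a := zl - p with ha
  set b := (2 : ℝ) • yl - zl - q with hb
  have hlin := ((((((hcross.neg.sub hsq).sub ((hz p).sub (hyl p))).sub (hyl a)).add_const ⟪p, a⟫).sub
    (((hyl q).sub (hz q)).sub (hxyv q))).sub ((hyl b).add (hxyv b))).add_const ⟪q, b⟫
  have hge : 0 ≤ (-0 - 0 - (⟪zl, p⟫ - ⟪yl, p⟫) - ⟪yl, a⟫ + ⟪p, a⟫ - (⟪yl, q⟫ - ⟪zl, q⟫ - 0)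
      - (⟪yl, b⟫ + 0) + ⟪q, b⟫ : ℝ) := by
    refine ge_of_tendsto hlin ?_
    filter_upwards [hy, hx] with k hyk hxk
    have h₁ := hB (z k) zl
    have h₂ := hA ((2 : ℝ) • y k - z k) ((2 : ℝ) • yl - zl)
    rw [← hyk, ← hp, ← ha] at h₁
    rw [← hxk, ← hq, ← hb] at h₂
    clear_value a b p q
    simp only [inner_sub_left, inner_sub_right, real_inner_smul_left] at *
    linarith [real_inner_comm (x k) (y k), real_inner_comm (x k) (z k), real_inner_comm (x k) b,
      real_inner_comm (y k) (z k), real_inner_comm (y k) a, real_inner_comm (y k) b,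
      real_inner_comm p a, real_inner_comm q b]
  have hfin : ‖yl - p‖ ^ 2 + ‖yl - q‖ ^ 2 ≤ 0 := by
    rw [ha, hb] at hge
    clear_value p q
    rw [← real_inner_self_eq_norm_sq, ← real_inner_self_eq_norm_sq]
    simp only [inner_sub_left, inner_sub_right, real_inner_smul_right] at *
    linarith [real_inner_comm yl p, real_inner_comm yl q, real_inner_comm yl zl,
      real_inner_comm zl p, real_inner_comm zl q]
  have e₁ : ‖yl - p‖ = 0 := by nlinarith [sq_nonneg ‖yl - p‖, sq_nonneg ‖yl - q‖]
  have e₂ : ‖yl - q‖ = 0 := by nlinarith [sq_nonneg ‖yl - p‖, sq_nonneg ‖yl - q‖]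
  exact ⟨sub_eq_zero.mp (norm_eq_zero.mp e₁), sub_eq_zero.mp (norm_eq_zero.mp e₂)⟩

end FirmlyNonexpansive

section WeakCompactness

variable {H : Type*} [NormedAddCommGroup H] [InnerProductSpace ℝ H]

/-- Along an ultrafilter, an eventually bounded family in a Hilbert space converges weakly. -/
theorem exists_weak_limit_ultrafilter [CompleteSpace H] {ι : Type*} (U : Ultrafilter ι) {x : ι → H} {C : ℝ}
    (hC : ∀ᶠ k in (U : Filter ι), ‖x k‖ ≤ C) :
    ∃ l : H, ∀ v, Tendsto (fun k => ⟪x k, v⟫) U (𝓝 ⟪l, v⟫) := by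
  have hex : ∀ v : H, ∃ r : ℝ, Tendsto (fun k => ⟪x k, v⟫) U (𝓝 r) ∧ ‖r‖ ≤ C * ‖v‖ := by
    intro v
    have hmem : ∀ᶠ k in (U : Filter ι), ⟪x k, v⟫ ∈ Metric.closedBall (0 : ℝ) (C * ‖v‖) := by
      filter_upwards [hC] with k hk
      rw [mem_closedBall_zero_iff]
      exact (norm_inner_le_norm _ _).trans (mul_le_mul_of_nonneg_right hk (norm_nonneg _))
    obtain ⟨r, hr, hle⟩ := (isCompact_closedBall (0 : ℝ) (C * ‖v‖)).ultrafilter_le_nhds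
      (U.map fun k => ⟪x k, v⟫) (le_principal_iff.mpr hmem)
    exact ⟨r, hle, mem_closedBall_zero_iff.mp hr⟩
  choose L hL hLC using hex
  let φ : H →ₗ[ℝ] ℝ :=
    { toFun := L
      map_add' := fun v v' => tendsto_nhds_unique (hL (v + v')) <| by
        simpa only [inner_add_right] using (hL v).add (hL v')
      map_smul' := fun c v => tendsto_nhds_unique (hL (c • v)) <| by
        simpa only [real_inner_smul_right, smul_eq_mul, RingHom.id_apply] using (hL v).const_mul c }
  let ψ : H →L[ℝ] ℝ := φ.mkContinuous C hLC
  refine ⟨(InnerProductSpace.toDual ℝ H).symm ψ, fun v => ?_⟩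
  rw [InnerProductSpace.toDual_symm_apply]
  exact hL v

/-- A sequence converging weakly to `l` along every free ultrafilter converges weakly to `l`. -/
theorem weakTendsto_of_ultrafilter {x : ℕ → H} {l : H}
    (h : ∀ U : Ultrafilter ℕ, (U : Filter ℕ) ≤ atTop →
      ∀ v, Tendsto (fun k => ⟪x k, v⟫) U (𝓝 ⟪l, v⟫)) : WeakTendsto x l := fun v =>
  (tendsto_iff_ultrafilter _ _ _).mpr fun U hU => h U hU v

/-- Two weak limits along finer filters coincide if the distances to both converge. -/
theorem weak_limit_unique_of_dist_tendsto {w : ℕ → H} {l₁ l₂ : Filter ℕ} [l₁.NeBot] [l₂.NeBot]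
    (h₁ : l₁ ≤ atTop) (h₂ : l₂ ≤ atTop) {s t : H}
    (hs : ∀ v, Tendsto (fun k => ⟪w k, v⟫) l₁ (𝓝 ⟪s, v⟫))
    (ht : ∀ v, Tendsto (fun k => ⟪w k, v⟫) l₂ (𝓝 ⟪t, v⟫))
    (hds : ∃ r, Tendsto (fun k => ‖w k - s‖ ^ 2) atTop (𝓝 r))
    (hdt : ∃ r, Tendsto (fun k => ‖w k - t‖ ^ 2) atTop (𝓝 r)) : s = t := by
  obtain ⟨r₁, hr₁⟩ := hds
  obtain ⟨r₂, hr₂⟩ := hdt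
  have hlim : Tendsto (fun k => ⟪w k, s - t⟫) atTop
      (𝓝 ((r₂ - r₁ + (‖s‖ ^ 2 - ‖t‖ ^ 2)) / 2)) := by
    refine (((hr₂.sub hr₁).add_const _).div_const 2).congr fun k => ?_
    rw [norm_sub_sq_real, norm_sub_sq_real, inner_sub_right]
    ring
  have e₁ := tendsto_nhds_unique (hs (s - t)) (hlim.mono_left h₁)
  have e₂ := tendsto_nhds_unique (ht (s - t)) (hlim.mono_left h₂)
  have e : ⟪s - t, s - t⟫ = 0 := by rw [inner_sub_left, e₁, e₂, sub_self]
  exact sub_eq_zero.mp (inner_self_eq_zero.mp e)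

end WeakCompactness

section InertialSequences

/-- A nonnegative sequence contracted up to a summable error is summable. -/
theorem summable_of_le_mul_add {u e : ℕ → ℝ} {q : ℝ} (hq : q < 1)
    (hu : ∀ k, 0 ≤ u k) (he0 : ∀ k, 0 ≤ e k) (he : Summable e)
    (h : ∀ k, u (k + 1) ≤ q * u k + e k) : Summable u := by
  refine summable_of_sum_range_le (c := (u 0 + ∑' k, e k) / (1 - q)) hu fun n => ?_
  rw [le_div_iff₀ (by linarith)]
  have hstep : ∑ k ∈ Finset.range n, u (k + 1)
      ≤ q * ∑ k ∈ Finset.range n, u k + ∑ k ∈ Finset.range n, e k := by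
    rw [Finset.mul_sum, ← Finset.sum_add_distrib]
    exact Finset.sum_le_sum fun k _ => h k
  have h₁ := Finset.sum_range_succ u n
  have h₂ := Finset.sum_range_succ' u n
  have h₃ := he.sum_le_tsum (Finset.range n) fun k _ => he0 k
  have h₄ := hu n
  linarith

/-- A nonnegative sequence whose increments have summable positive part converges. -/
theorem exists_tendsto_of_summable_posPart {φ : ℕ → ℝ} (h0 : ∀ k, 0 ≤ φ k)
    (hs : Summable fun k => max (φ (k + 1) - φ k) 0) : ∃ r, Tendsto φ atTop (𝓝 r) := by
  set S : ℕ → ℝ := fun n => ∑ k ∈ Finset.range n, max (φ (k + 1) - φ k) 0 with hS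
  have hanti : Antitone fun n => φ n - S n := by
    refine antitone_nat_of_succ_le fun n => ?_
    have := le_max_left (φ (n + 1) - φ n) 0
    simp only [hS, Finset.sum_range_succ]
    linarith
  have hbdd : BddBelow (Set.range fun n => φ n - S n) := by
    refine ⟨-∑' k, max (φ (k + 1) - φ k) 0, ?_⟩
    rintro _ ⟨n, rfl⟩
    have := hs.sum_le_tsum (Finset.range n) fun k _ => le_max_right (φ (k + 1) - φ k) 0
    have := h0 n
    simp only [hS]
    linarith
  exact ⟨_, ((tendsto_atTop_ciInf hanti hbdd).add hs.hasSum.tendsto_sum_nat).congr fun n => by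
    simp [hS]⟩

/-- The convergence principle for inertial Fejér-type recursions. -/
theorem inertial_fejer {φ a e d : ℕ → ℝ} {q c : ℝ} (hq : q < 1) (hc : 0 < c)
    (hφ : ∀ k, 0 ≤ φ k) (ha : ∀ k, 0 ≤ a k ∧ a k ≤ q) (he0 : ∀ k, 0 ≤ e k) (he : Summable e)
    (hd : ∀ k, 0 ≤ d k)
    (h : ∀ k, φ (k + 2) - φ (k + 1) ≤ a k * (φ (k + 1) - φ k) + e k - c * d k) :
    (∃ r, Tendsto φ atTop (𝓝 r)) ∧ Tendsto d atTop (𝓝 0) := by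
  have hq0 : 0 ≤ q := (ha 0).1.trans (ha 0).2
  have hmul : ∀ k, a k * (φ (k + 1) - φ k) ≤ q * max (φ (k + 1) - φ k) 0 := fun k =>
    (mul_le_mul_of_nonneg_left (le_max_left _ 0) (ha k).1).trans
      (mul_le_mul_of_nonneg_right (ha k).2 (le_max_right _ _))
  have hpos : Summable fun k => max (φ (k + 1) - φ k) 0 := by
    refine summable_of_le_mul_add hq (fun k => le_max_right _ _) he0 he fun k => ?_
    refine max_le ?_ (add_nonneg (mul_nonneg hq0 (le_max_right _ _)) (he0 k))
    have := mul_nonneg hc.le (hd k)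
    linarith [h k, hmul k]
  obtain ⟨r, hr⟩ := exists_tendsto_of_summable_posPart hφ hpos
  refine ⟨⟨r, hr⟩, ?_⟩
  have h1 := (tendsto_add_atTop_iff_nat 1).mpr hr
  have h2 := (tendsto_add_atTop_iff_nat 2).mpr hr
  have hlim := ((((hpos.tendsto_atTop_zero.const_mul q).add he.tendsto_atTop_zero).add
    (h1.sub h2)).div_const c)
  simp only [mul_zero, add_zero, sub_self, zero_div] at hlim
  refine squeeze_zero hd (fun k => ?_) hlim
  rw [le_div_iff₀ hc]
  linarith [h k, hmul k]

end InertialSequences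

section InertialStep

variable {H : Type*} [NormedAddCommGroup H] [InnerProductSpace ℝ H]

/-- One relaxed inertial step decreases the squared distance to `s` up to the inertial error. -/
theorem inertial_step_norm_sq_le {w w' z s r : H} {a l : ℝ} (ha : 0 ≤ a) (ha1 : a ≤ 1)
    (hl : 0 ≤ l) (hz : z = w' + a • (w' - w)) (hr : ⟪z - s, r⟫ ≤ -‖r‖ ^ 2) :
    ‖z + l • r - s‖ ^ 2 - ‖w' - s‖ ^ 2
      ≤ a * (‖w' - s‖ ^ 2 - ‖w - s‖ ^ 2) + 2 * (a * ‖w' - w‖ ^ 2) - l * (2 - l) * ‖r‖ ^ 2 := by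
  have h₁ : ‖z + l • r - s‖ ^ 2 = ‖z - s‖ ^ 2 + 2 * l * ⟪z - s, r⟫ + l ^ 2 * ‖r‖ ^ 2 := by
    have : z + l • r - s = (z - s) + l • r := by abel
    rw [this, norm_add_sq_real, inner_smul_right, norm_smul, mul_pow, Real.norm_eq_abs, sq_abs]
    ring
  have h₂ : ‖z - s‖ ^ 2
      = (1 + a) * ‖w' - s‖ ^ 2 - a * ‖w - s‖ ^ 2 + a * (1 + a) * ‖w' - w‖ ^ 2 := by
    have e₁ : z - s = (w' - s) + a • (w' - w) := by rw [hz]; abel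
    have e₂ : w - s = (w' - s) - (w' - w) := by abel
    rw [e₁, e₂, norm_add_sq_real, norm_sub_sq_real (w' - s), inner_smul_right, norm_smul, mul_pow,
      Real.norm_eq_abs, sq_abs]
    ring
  have h₃ := mul_le_mul_of_nonneg_left hr hl
  have h₄ : a * (1 + a) * ‖w' - w‖ ^ 2 ≤ 2 * (a * ‖w' - w‖ ^ 2) := by
    nlinarith [mul_nonneg ha (sq_nonneg ‖w' - w‖)]
  rw [h₁, h₂]
  linarith

end InertialStep

theorem inertial_DR_weak_convergence
    {H : Type*} [NormedAddCommGroup H] [InnerProductSpace ℝ H] [CompleteSpace H]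
    (f g : H → EReal) (hf : ProperConvexLSC f) (hg : ProperConvexLSC g)
    (γ : ℝ) (hγ : 0 < γ)
    (proxf proxg : H → H)
    (hproxf : ∀ c, IsProx γ f c (proxf c)) (hproxg : ∀ c, IsProx γ g c (proxg c))
    (hzer : ∃ x : H, ∃ u ∈ subdiff f x, ∃ v ∈ subdiff g x, u + v = 0)
    (α lam : ℕ → ℝ) (αbar llo lhi : ℝ)
    (hα : ∀ k, 0 ≤ α k ∧ α k ≤ αbar) (hαbar : αbar < 1)
    (hllo : 0 < llo) (hlam : ∀ k, llo ≤ lam k ∧ lam k ≤ lhi) (hlhi : lhi < 2)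
    (w y x : ℕ → H)
    (hy : ∀ k, 1 ≤ k → y k = proxg (w k + α k • (w k - w (k - 1))))
    (hx : ∀ k, 1 ≤ k → x k = proxf ((2 : ℝ) • y k - w k - α k • (w k - w (k - 1))))
    (hw : ∀ k, 1 ≤ k → w (k + 1) = w k + α k • (w k - w (k - 1)) + lam k • (x k - y k))
    (hsum : Summable fun k => α (k + 1) * ‖w (k + 1) - w k‖ ^ 2) :
    ∃ xbar : H,
      WeakTendsto w xbar ∧
      WeakTendsto y (proxg xbar) ∧
      WeakTendsto x (proxg xbar) ∧
      proxg xbar = proxf ((2 : ℝ) • proxg xbar - xbar) := by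
  have hA := firmlyNonexpansive_of_isProx hf hγ hproxf
  have hB := firmlyNonexpansive_of_isProx hg hγ hproxg
  set z : ℕ → H := fun k => w k + α k • (w k - w (k - 1)) with hzdef
  have hyz : ∀ k, 1 ≤ k → y k = proxg (z k) := hy
  have hxz : ∀ k, 1 ≤ k → x k = proxf ((2 : ℝ) • y k - z k) := fun k hk => by
    rw [hx k hk, hzdef, sub_sub]
  have hfejer : ∀ s, proxg s = proxf ((2 : ℝ) • proxg s - s) →
      (∃ r, Tendsto (fun k => ‖w k - s‖ ^ 2) atTop (𝓝 r)) ∧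
        Tendsto (fun k => ‖x (k + 1) - y (k + 1)‖ ^ 2) atTop (𝓝 0) := by
    intro s hs
    refine inertial_fejer (a := fun k => α (k + 1))
      (e := fun k => 2 * (α (k + 1) * ‖w (k + 1) - w k‖ ^ 2)) (c := llo * (2 - lhi)) hαbar
      (mul_pos hllo (by linarith)) (fun k => sq_nonneg _) (fun k => hα (k + 1))
      (fun k => mul_nonneg zero_le_two (mul_nonneg (hα _).1 (sq_nonneg _)))
      (hsum.mul_left 2) (fun k => sq_nonneg _) fun k => ?_
    have hk : 1 ≤ k + 1 := Nat.le_add_left 1 k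
    have hin := inner_douglasRachford_step_le hA hB hs (z (k + 1))
    rw [← hyz _ hk, ← hxz _ hk] at hin
    have hstep := inertial_step_norm_sq_le (w := w k) (z := z (k + 1)) (hα (k + 1)).1
      ((hα (k + 1)).2.trans hαbar.le) (hllo.le.trans (hlam (k + 1)).1) rfl hin
    have hwk : w (k + 2) = z (k + 1) + lam (k + 1) • (x (k + 1) - y (k + 1)) := hw (k + 1) hk
    have hcoef : llo * (2 - lhi) ≤ lam (k + 1) * (2 - lam (k + 1)) := by
      have := hlam (k + 1)
      exact mul_le_mul this.1 (by linarith) (by linarith) (by linarith)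
    have := mul_le_mul_of_nonneg_right hcoef (sq_nonneg ‖x (k + 1) - y (k + 1)‖)
    rw [← hwk] at hstep
    linarith
  obtain ⟨s, hs⟩ : ∃ s, proxg s = proxf ((2 : ℝ) • proxg s - s) := by
    obtain ⟨p, u, hu, v, hv, huv⟩ := hzer
    have e₁ : proxg (p + γ • v) = p := isProx_eq_of_mem_subdiff hg hγ (hproxg _) hv
    refine ⟨p + γ • v, ?_⟩
    have e₂ : (2 : ℝ) • p - (p + γ • v) = p + γ • u := by
      rw [eq_neg_of_add_eq_zero_left huv]; module
    rw [e₁, e₂]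
    exact (isProx_eq_of_mem_subdiff hf hγ (hproxf _) hu).symm
  have hzw : Tendsto (fun k => z k - w k) atTop (𝓝 0) := by
    rw [← tendsto_add_atTop_iff_nat 1, tendsto_zero_iff_norm_tendsto_zero]
    have hsq : Tendsto (fun k => ‖z (k + 1) - w (k + 1)‖ ^ 2) atTop (𝓝 0) := by
      refine squeeze_zero (fun k => sq_nonneg _) (fun k => ?_) hsum.tendsto_atTop_zero
      have e : z (k + 1) - w (k + 1) = α (k + 1) • (w (k + 1) - w k) := by simp [hzdef]
      rw [e, norm_smul, mul_pow, Real.norm_eq_abs, sq_abs]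
      refine mul_le_mul_of_nonneg_right ?_ (sq_nonneg _)
      nlinarith [(hα (k + 1)).1, (hα (k + 1)).2]
    simpa using hsq.sqrt
  have hxy : Tendsto (fun k => x k - y k) atTop (𝓝 0) := by
    rw [← tendsto_add_atTop_iff_nat 1, tendsto_zero_iff_norm_tendsto_zero]
    simpa using (hfejer s hs).2.sqrt
  obtain ⟨r, hr⟩ := (hfejer s hs).1
  have hr' : Tendsto (fun k => ‖w k - s‖) atTop (𝓝 √r) := by simpa using hr.sqrt
  have hwb : ∀ᶠ k in atTop, ‖w k - s‖ ≤ √r + 1 := hr'.eventually_le_const (by linarith)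
  have hzwb : ∀ᶠ k in atTop, ‖z k - w k‖ ≤ 1 := by
    have := hzw.norm
    rw [norm_zero] at this
    exact this.eventually_le_const one_pos
  have hzb : ∀ᶠ k in atTop, ‖z k - s‖ ≤ √r + 2 := by
    filter_upwards [hwb, hzwb] with k h₁ h₂
    linarith [norm_sub_le_norm_sub_add_norm_sub (z k) (w k) s]
  have hyb : ∀ᶠ k in atTop, ‖y k - proxg s‖ ≤ √r + 2 := by
    filter_upwards [hzb, eventually_ge_atTop 1] with k h₁ hk
    rw [hyz k hk]
    exact (hB.norm_sub_le _ _).trans h₁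
  have hbound : ∀ {u : ℕ → H} {c : H} {C : ℝ}, (∀ᶠ k in atTop, ‖u k - c‖ ≤ C) →
      ∀ᶠ k in atTop, ‖u k‖ ≤ C + ‖c‖ := fun {u c C} h => h.mono fun k hk => by
    linarith [norm_le_norm_sub_add (u k) c]
  have hcluster : ∀ U : Ultrafilter ℕ, (U : Filter ℕ) ≤ atTop → ∃ t,
      (∀ v, Tendsto (fun k => ⟪w k, v⟫) U (𝓝 ⟪t, v⟫)) ∧
      (∀ v, Tendsto (fun k => ⟪y k, v⟫) U (𝓝 ⟪proxg t, v⟫)) ∧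
      proxg t = proxf ((2 : ℝ) • proxg t - t) := by
    intro U hU
    obtain ⟨t, ht⟩ := exists_weak_limit_ultrafilter U (hU (hbound hwb))
    obtain ⟨q, hq⟩ := exists_weak_limit_ultrafilter U (hU (hbound hyb))
    have htz : ∀ v, Tendsto (fun k => ⟪z k, v⟫) U (𝓝 ⟪t, v⟫) := fun v => by
      have h0 : Tendsto (fun k => ⟪z k - w k, v⟫) U (𝓝 0) := by
        simpa using (hzw.mono_left hU).inner (tendsto_const_nhds (x := v))
      simpa [← inner_add_left] using h0.add (ht v)
    obtain ⟨e₁, e₂⟩ := douglasRachford_demiclosed hA hB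
      (hU ((eventually_ge_atTop 1).mono hyz)) (hU ((eventually_ge_atTop 1).mono hxz))
      (hU (hbound hzb)) (hxy.mono_left hU) htz hq
    refine ⟨t, ht, e₁ ▸ hq, e₁ ▸ e₂⟩
  obtain ⟨t, ht, -, htfix⟩ := hcluster (hyperfilter ℕ) Nat.hyperfilter_le_atTop
  have hall : ∀ U : Ultrafilter ℕ, (U : Filter ℕ) ≤ atTop →
      (∀ v, Tendsto (fun k => ⟪w k, v⟫) U (𝓝 ⟪t, v⟫)) ∧
      (∀ v, Tendsto (fun k => ⟪y k, v⟫) U (𝓝 ⟪proxg t, v⟫)) := by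
    intro U hU
    obtain ⟨t', h₁, h₂, h₃⟩ := hcluster U hU
    obtain rfl : t' = t := weak_limit_unique_of_dist_tendsto hU Nat.hyperfilter_le_atTop h₁ ht
      (hfejer t' h₃).1 (hfejer t htfix).1
    exact ⟨h₁, h₂⟩
  have hyw : WeakTendsto y (proxg t) := weakTendsto_of_ultrafilter fun U hU => (hall U hU).2
  refine ⟨t, weakTendsto_of_ultrafilter fun U hU => (hall U hU).1, hyw, fun v => ?_, htfix⟩
  have h0 : Tendsto (fun k => ⟪x k - y k, v⟫) atTop (𝓝 0) := by
    simpa using hxy.inner (tendsto_const_nhds (x := v))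
  simpa [← inner_add_left] using h0.add (hyw v)
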